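/- Let A be an associative unital algebra over ℂ, B a unital subalgebra, ĝ = {X ∈ Der(A) : X|_B = 0} and h = {X ∈ Der(A) : X(B) ⊆ B}, so ĝ is a Lie ideal of h. Let M be an A-bimodule and ∇ : Der(A) → End_ℂ(M) a ℂ-linear map such that ∇_{zX} m = z·∇_X m for z ∈ Z(A) and ∇_X(a·m·b) = (Xa)·m·b + a·(∇_X m)·b + a·m·(Xb) for all a, b ∈ A, m ∈ M. Suppose the curvature R(X,Y) = ∇_X∇_Y − ∇_Y∇_X − ∇_{[X,Y]} vanishes whenever X ∈ ĝ. Set M^ĝ = {m ∈ M : ∇_Z m = 0 for all Z ∈ ĝ}. Then: (i) for every X ∈ h, ∇_X(M^ĝ) ⊆ M^ĝ; (ii) for X, X' ∈ h with X − X' ∈ ĝ and m ∈ M^ĝ, ∇_X m = ∇_{X'} m; and (iii) M^ĝ is stable under left and right multiplication by every b ∈ B. -/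

import Mathlib

open MulOpposite

set_option synthInstance.maxHeartbeats 1000000

/-- A ℂ-linear map `X : A → A` is a derivation if it satisfies the Leibniz rule. -/
def IsDerivation {A : Type*} [Ring A] [Algebra ℂ A] (X : A →ₗ[ℂ] A) : Prop :=
  ∀ a b : A, X (a * b) = X a * b + a * X b

/-- The reduced bimodule `M^ĝ = {m ∈ M : ∇_Z m = 0 for all Z ∈ ĝ}`, where
`ĝ` is the Lie algebra of derivations of `A` vanishing on the subalgebra `B`. -/
def reducedMod {A M : Type*} [Ring A] [Algebra ℂ A] (B : Subalgebra ℂ A)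
    [AddCommGroup M] [Module ℂ M] (nabla : (A →ₗ[ℂ] A) → M →ₗ[ℂ] M) : Set M :=
  {m | ∀ Z : A →ₗ[ℂ] A, IsDerivation Z → (∀ b ∈ B, Z b = 0) → nabla Z m = 0}

theorem stmt_13 {A M : Type*} [Ring A] [Algebra ℂ A] (B : Subalgebra ℂ A)
    -- M is a bimodule over A (with compatible ℂ-structure)
    [AddCommGroup M] [Module ℂ M]
    [Module A M] [IsScalarTower ℂ A M]
    [Module Aᵐᵒᵖ M] [IsScalarTower ℂ Aᵐᵒᵖ M] [SMulCommClass A Aᵐᵒᵖ M]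
    -- ∇ is a connection on M
    (nabla : (A →ₗ[ℂ] A) → M →ₗ[ℂ] M)
    (hadd : ∀ X Y : A →ₗ[ℂ] A, IsDerivation X → IsDerivation Y →
      nabla (X + Y) = nabla X + nabla Y)
    (hsmul : ∀ z : A, (∀ a : A, z * a = a * z) → ∀ X : A →ₗ[ℂ] A, IsDerivation X →
      ∀ m : M, nabla (z • X) m = z • nabla X m)
    (hleib : ∀ X : A →ₗ[ℂ] A, IsDerivation X → ∀ a b : A, ∀ m : M,
      nabla X (a • op b • m) =
        (X a) • op b • m + a • op b • nabla X m + a • op (X b) • m)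
    -- the curvature R(X,Y) vanishes whenever X ∈ ĝ
    (hflat : ∀ X : A →ₗ[ℂ] A, IsDerivation X → (∀ b ∈ B, X b = 0) →
      ∀ Y : A →ₗ[ℂ] A, IsDerivation Y → ∀ m : M,
        nabla X (nabla Y m) - nabla Y (nabla X m) - nabla (X ∘ₗ Y - Y ∘ₗ X) m = 0) :
    -- (i) ∇_X preserves M^ĝ for every X ∈ h
    (∀ X : A →ₗ[ℂ] A, IsDerivation X → (∀ b ∈ B, X b ∈ B) →
      ∀ m ∈ reducedMod B nabla, nabla X m ∈ reducedMod B nabla) ∧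
    -- (ii) on M^ĝ, ∇_X only depends on the class of X ∈ h modulo ĝ
    (∀ X X' : A →ₗ[ℂ] A, IsDerivation X → IsDerivation X' →
      (∀ b ∈ B, X b ∈ B) → (∀ b ∈ B, X' b ∈ B) →
      (∀ b ∈ B, X b = X' b) →
      ∀ m ∈ reducedMod B nabla, nabla X m = nabla X' m) ∧
    -- (iii) M^ĝ is stable under left and right multiplication by elements of B
    (∀ b ∈ B, ∀ m ∈ reducedMod B nabla,
      b • m ∈ reducedMod B nabla ∧ op b • m ∈ reducedMod B nabla) := by
  refine ⟨?_, ?_, ?_⟩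
  · intro X hX hXB m hm Z hZ hZB
    have h := hflat Z hZ hZB X hX m
    have hD : IsDerivation (Z ∘ₗ X - X ∘ₗ Z) := by
      intro a b
      simp only [LinearMap.sub_apply, LinearMap.comp_apply, hX a b, hZ a b, map_add,
        hX _ _, hZ _ _]
      noncomm_ring
    have hDB : ∀ b ∈ B, (Z ∘ₗ X - X ∘ₗ Z) b = 0 := by
      intro b hb
      simp [hZB b hb, hZB _ (hXB b hb)]
    rw [hm Z hZ hZB, hm _ hD hDB] at h
    simpa using h
  · intro X X' hX hX' _ _ hXX m hm
    have hD : IsDerivation (X - X') := by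
      intro a b
      simp only [LinearMap.sub_apply, hX a b, hX' a b]
      noncomm_ring
    have h0 := hm _ hD (fun b hb => by simp [hXX b hb])
    have h := hadd (X - X') X' hD hX'
    rw [sub_add_cancel] at h
    rw [h, LinearMap.add_apply, h0, zero_add]
  · intro b hb m hm
    constructor
    · intro Z hZ hZB
      have h := hleib Z hZ b 1 m
      simpa [hZB b hb, hZB 1 B.one_mem, hm Z hZ hZB] using h
    · intro Z hZ hZB
      have h := hleib Z hZ 1 b m
      simpa [hZB b hb, hZB 1 B.one_mem, hm Z hZ hZB] using h
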